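/- arXiv:1304.3333 — 2 statements merged into one kernel-verified Lean document; each statement's English description precedes it below -/
import Mathlib

section
/- Let ℓ be a prime number and let K be a number field with [K:ℚ] = ℓ such that K/ℚ is not a Galois extension. Let L be the normal closure of K over ℚ (inside a fixed algebraic closure of ℚ), and let k ⊆ L be a subfield such that k/ℚ is a cyclic Galois extension of prime degree q. Let a ∈ ℚ^× and let p be a prime number that is unramified in L (every prime ideal of the ring of integers of L above p has ramification index 1) and inert in k (the ideal generated by p in the ring of integers of k is a prime ideal). Then there exists x ∈ K ⊗_ℚ ℚ_p with N_{(K⊗ℚ_p)/ℚ_p}(x) = a. -/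
open scoped TensorProduct NumberField


theorem aux_leftMulMatrix (K : Type) [Field K] [NumberField K] (p : ℕ) [Fact p.Prime] (z : 𝓞 K) :
    Algebra.leftMulMatrix (Algebra.TensorProduct.basis ℚ_[p] (NumberField.integralBasis K))
      ((1 : ℚ_[p]) ⊗ₜ[ℚ] (z : K)) =
    (Algebra.leftMulMatrix (NumberField.RingOfIntegers.basis K) z).map (Int.cast) := by
  classical
  ext i j
  rw [Algebra.leftMulMatrix_eq_repr_mul, Matrix.map_apply, Algebra.leftMulMatrix_eq_repr_mul,
    Algebra.TensorProduct.basis_apply, Algebra.TensorProduct.tmul_mul_tmul, one_mul,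
    Algebra.TensorProduct.basis_repr_tmul, NumberField.integralBasis_apply, ← map_mul]
  have := NumberField.integralBasis_repr_apply K (z * NumberField.RingOfIntegers.basis K j) i
  simp at this ⊢
  rw [this]
  simp

theorem aux_norm (K : Type) [Field K] [NumberField K] (p : ℕ) [Fact p.Prime] (z : K) :
    Algebra.norm ℚ_[p] ((1 : ℚ_[p]) ⊗ₜ[ℚ] z) = (Algebra.norm ℚ z : ℚ_[p]) := by
  classical
  rw [Algebra.norm_eq_matrix_det (Algebra.TensorProduct.basis ℚ_[p] (NumberField.integralBasis K)),
    Algebra.norm_eq_matrix_det (NumberField.integralBasis K)]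
  have := RingHom.map_det (Rat.castHom ℚ_[p]) (Algebra.leftMulMatrix (NumberField.integralBasis K) z)
  rw [Rat.coe_castHom] at this
  rw [this]
  congr 1
  ext i j
  simp [Algebra.leftMulMatrix_eq_repr_mul]

theorem aux_norm_one_sub (K : Type) [Field K] [NumberField K] (p : ℕ) [Fact p.Prime] (y : 𝓞 K)
    (t : ℤ_[p]) :
    Algebra.norm ℚ_[p] (1 - (t : ℚ_[p]) ⊗ₜ[ℚ] (y : K)) =
      ((Polynomial.aeval t
        (Algebra.leftMulMatrix (NumberField.RingOfIntegers.basis K) y).charpolyRev : ℤ_[p]) : ℚ_[p]) := by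
  classical
  set M := Algebra.leftMulMatrix (NumberField.RingOfIntegers.basis K) y with hM
  have h1 : (1 - (t : ℚ_[p]) ⊗ₜ[ℚ] (y : K)) = 1 - (t : ℚ_[p]) • ((1 : ℚ_[p]) ⊗ₜ[ℚ] (y : K)) := by
    rw [TensorProduct.smul_tmul']; simp
  rw [Algebra.norm_eq_matrix_det (Algebra.TensorProduct.basis ℚ_[p] (NumberField.integralBasis K)),
    h1, map_sub, map_one, map_smul, aux_leftMulMatrix, ← hM, Matrix.charpolyRev]
  have h2 := AlgHom.map_det (Polynomial.aeval t : Polynomial ℤ →ₐ[ℤ] ℤ_[p]) (1 - (Polynomial.X : Polynomial ℤ) • M.map Polynomial.C)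
  rw [h2]
  have h3 := RingHom.map_det (PadicInt.Coe.ringHom (p := p)) ((Polynomial.aeval t : Polynomial ℤ →ₐ[ℤ] ℤ_[p]).mapMatrix (1 - (Polynomial.X : Polynomial ℤ) • M.map Polynomial.C))
  refine Eq.trans ?_ h3.symm
  congr 1
  ext i j
  by_cases hij : i = j
  · subst hij
    simp
    exact Or.inl rfl
  · simp [hij]
    exact Or.inl rfl

theorem aux_hensel (K : Type) [Field K] [NumberField K] (p : ℕ) [hp : Fact p.Prime] (x0 y : 𝓞 K)
    (u : ℤ_[p]) (hu : ‖u‖ = 1) (hx0 : ‖(Algebra.norm ℤ x0 : ℤ_[p]) - u‖ < 1)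
    (hy : ¬ (p : ℤ) ∣ Algebra.trace ℤ (𝓞 K) y) :
    ∃ x : ℚ_[p] ⊗[ℚ] K, Algebra.norm ℚ_[p] x = (u : ℚ_[p]) := by
  classical
  set M := Algebra.leftMulMatrix (NumberField.RingOfIntegers.basis K) y with hM
  have htr : M.trace = Algebra.trace ℤ (𝓞 K) y := by
    rw [Algebra.trace_eq_matrix_trace (NumberField.RingOfIntegers.basis K)]
  have hn : ‖(Algebra.norm ℤ x0 : ℤ_[p])‖ = 1 := by
    apply le_antisymm (PadicInt.norm_le_one _)
    by_contra! h
    have : ‖u‖ < 1 := by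
      have h2 : u = (Algebra.norm ℤ x0 : ℤ_[p]) - ((Algebra.norm ℤ x0 : ℤ_[p]) - u) := by ring
      rw [h2, sub_eq_add_neg]
      refine lt_of_le_of_lt (PadicInt.nonarchimedean _ _) (max_lt h ?_)
      rwa [norm_neg]
    linarith
  let F : Polynomial ℤ_[p] := Polynomial.C (Algebra.norm ℤ x0 : ℤ_[p]) *
    (M.charpolyRev.map (Int.castRingHom ℤ_[p])) - Polynomial.C u
  have hF0 : ‖F.aeval (0 : ℤ_[p])‖ < 1 := by
    have : M.charpolyRev.coeff 0 = 1 := by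
      rw [Polynomial.coeff_zero_eq_eval_zero, Matrix.eval_charpolyRev]
    simpa [F, ← Polynomial.coeff_zero_eq_aeval_zero, this] using hx0
  have hF1 : ‖F.derivative.aeval (0 : ℤ_[p])‖ = 1 := by
    have h1 : F.derivative.aeval (0 : ℤ_[p]) =
      - ((Algebra.norm ℤ x0 : ℤ_[p]) * ((Algebra.trace ℤ (𝓞 K) y : ℤ) : ℤ_[p])) := by
      rw [Polynomial.coe_aeval_eq_eval, ← Polynomial.coeff_zero_eq_eval_zero, Polynomial.coeff_derivative]
      simp [F, htr]
    rw [h1, norm_neg, norm_mul, hn, one_mul]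
    apply le_antisymm (PadicInt.norm_le_one _)
    by_contra! h
    exact hy (PadicInt.norm_int_lt_one_iff_dvd _ |>.1 h)
  obtain ⟨t, ht, -⟩ := hensels_lemma (F := F) (a := 0) (by rw [hF1]; simpa using hF0)
  refine ⟨((1 : ℚ_[p]) ⊗ₜ[ℚ] (x0 : K)) * (1 - (t : ℚ_[p]) ⊗ₜ[ℚ] (y : K)), ?_⟩
  rw [map_mul, aux_norm_one_sub, aux_norm]
  have h5 : (Algebra.norm ℤ x0 : ℤ_[p]) * Polynomial.aeval t M.charpolyRev = u := by
    simp only [F, map_sub, map_mul, Polynomial.aeval_C, sub_eq_zero] at ht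
    simpa [Polynomial.aeval_def, Polynomial.eval₂_map] using ht
  rw [← h5, ← hM]
  have h6 : Algebra.norm ℚ (x0 : K) = ((Algebra.norm ℤ x0 : ℤ) : ℚ) := by
    rw [Algebra.coe_norm_int]
  rw [h6]
  simp


theorem aux_val (K : Type) [Field K] [NumberField K] (p : ℕ) [hp : Fact p.Prime]
    (ℓ : ℕ) (hℓ : ℓ.Prime) (hdeg : Module.finrank ℚ K = ℓ)
    (P : Ideal (𝓞 K)) [P.IsPrime] (hpP : (p : 𝓞 K) ∈ P) (f : ℕ) (hf : Nat.card (𝓞 K ⧸ P) = p ^ f)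
    (hlf : ¬ ℓ ∣ f) (n : ℤ) :
    ∃ x : K, x ≠ 0 ∧ padicValRat p (Algebra.norm ℚ x) = n := by
  have hp0 : (p : 𝓞 K) ≠ 0 := by exact_mod_cast hp.1.ne_zero
  have hP0 : P ≠ ⊥ := by
    rintro rfl
    exact hp0 (by simpa using hpP)
  have hPp : P * Ideal.span {(p : 𝓞 K)} ≠ 0 := by
    refine mul_ne_zero hP0 ?_
    simpa using hp0
  obtain ⟨a, ha⟩ := IsDedekindDomain.exists_sup_span_eq (Ideal.mul_le_left : P * Ideal.span {(p : 𝓞 K)} ≤ P) hPp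
  have haP : Ideal.span {a} ≤ P := by
    rw [← ha]; exact le_sup_right
  obtain ⟨I, hI⟩ := Ideal.dvd_iff_le.2 haP
  have htop : Ideal.span {(p : 𝓞 K)} ⊔ I = ⊤ := by
    rw [hI, ← Ideal.mul_sup] at ha
    have : P * (Ideal.span {(p : 𝓞 K)} ⊔ I) = P * 1 := by rw [ha, mul_one]
    simpa using mul_left_cancel₀ hP0 this
  have hpI : ¬ p ∣ Ideal.absNorm I := by
    intro h
    obtain ⟨Q, hQ, hQp, hQI⟩ := Ideal.exists_isMaximal_dvd_of_dvd_absNorm' hp.1 I h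
    apply hQ.ne_top
    rw [eq_top_iff, ← htop, sup_le_iff]
    refine ⟨?_, Ideal.dvd_iff_le.1 hQI⟩
    rw [Ideal.span_singleton_le_iff_mem]
    have : (p : ℤ) ∈ Q.under ℤ := by rw [hQp]; exact Ideal.mem_span_singleton_self _
    simpa [Ideal.under_def] using this
  have hPn : Ideal.absNorm P = p ^ f := by
    rw [Ideal.absNorm_apply, Submodule.cardQuot_apply]; exact hf
  have hna : (Algebra.norm ℤ a).natAbs = p ^ f * Ideal.absNorm I := by
    rw [← Ideal.absNorm_span_singleton, hI, map_mul, hPn]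
  have hI0 : Ideal.absNorm I ≠ 0 := fun h => hpI (by simp [h])
  have ha0 : a ≠ 0 := by
    rintro rfl
    simp [hI0, hp.1.ne_zero] at hna
  have hva : padicValRat p (Algebra.norm ℚ (a : K)) = f := by
    rw [← Algebra.coe_norm_int, padicValRat.of_int, padicValInt, hna,
      padicValNat.mul (by simp [hp.1.ne_zero]) hI0, padicValNat.prime_pow,
      padicValNat.eq_zero_of_not_dvd hpI]
    simp
  have hvp : padicValRat p (Algebra.norm ℚ (p : K)) = ℓ := by
    have : (p : K) = algebraMap ℚ K p := by simp
    rw [this, Algebra.norm_algebraMap, hdeg, padicValRat.pow]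
    simp [hp.1.one_lt]
  have hcop : Nat.Coprime ℓ f := (Nat.Prime.coprime_iff_not_dvd hℓ).2 hlf
  have hbez := Nat.gcd_eq_gcd_ab ℓ f
  rw [hcop] at hbez
  have haK : (a : K) ≠ 0 := by simpa using ha0
  have hpK : (p : K) ≠ 0 := by exact_mod_cast hp.1.ne_zero
  refine ⟨((p : K) ^ (Nat.gcdA ℓ f) * (a : K) ^ (Nat.gcdB ℓ f)) ^ n, by positivity, ?_⟩
  have hz : ∀ (q : ℚ) (m : ℤ), q ≠ 0 → padicValRat p (q ^ m) = m * padicValRat p q := by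
    intro q m hq
    exact padicValRat.zpow ..
  have hnp : Algebra.norm ℚ (p : K) ≠ 0 := by rwa [Algebra.norm_ne_zero_iff]
  have hna' : Algebra.norm ℚ (a : K) ≠ 0 := by rwa [Algebra.norm_ne_zero_iff]
  let φ : K →*₀ ℚ := { Algebra.norm ℚ with map_zero' := Algebra.norm_zero }
  have hφ : ∀ (z : K) (m : ℤ), Algebra.norm ℚ (z ^ m) = (Algebra.norm ℚ z) ^ m :=
    fun z m => map_zpow₀ φ z m
  rw [hφ, map_mul, hφ, hφ, hz _ _ (by positivity), 
    padicValRat.mul (by positivity) (by positivity), hz _ _ hnp, hz _ _ hna', hva, hvp]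
  push_cast at hbez
  linear_combination (-n) * hbez

theorem aux_final (K : Type) [Field K] [NumberField K] (p : ℕ) [hp : Fact p.Prime]
    (hv : ∀ n : ℤ, ∃ x : K, x ≠ 0 ∧ padicValRat p (Algebra.norm ℚ x) = n)
    (hnorm : ∀ z : K, Algebra.norm ℚ_[p] ((1 : ℚ_[p]) ⊗ₜ[ℚ] z) = (Algebra.norm ℚ z : ℚ_[p]))
    (hu : ∀ u : ℤ_[p], ‖u‖ = 1 → ∃ x : ℚ_[p] ⊗[ℚ] K, Algebra.norm ℚ_[p] x = (u : ℚ_[p]))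
    (a : ℚ) (ha : a ≠ 0) :
    ∃ x : ℚ_[p] ⊗[ℚ] K, Algebra.norm ℚ_[p] x = (a : ℚ_[p]) := by
  obtain ⟨x, hx0, hx⟩ := hv (padicValRat p a)
  have hN : Algebra.norm ℚ x ≠ 0 := by rwa [Algebra.norm_ne_zero_iff]
  have h1 : ‖((a / Algebra.norm ℚ x : ℚ) : ℚ_[p])‖ = 1 := by
    rw [Padic.eq_padicNorm, padicNorm.eq_zpow_of_nonzero (div_ne_zero ha hN), padicValRat.div ha hN, hx]
    simp
  obtain ⟨w, hw⟩ := hu ⟨_, h1.le⟩ h1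
  refine ⟨(1 : ℚ_[p]) ⊗ₜ[ℚ] x * w, ?_⟩
  rw [map_mul, hw, hnorm]
  simp only [← Rat.cast_mul]
  rw [mul_div_cancel₀ _ hN]

section
open scoped Pointwise

attribute [local instance] Ideal.Quotient.field

theorem aux_max (p : ℕ) [hp : Fact p.Prime] : (Ideal.span {(p : ℤ)}).IsMaximal :=
    ((Ideal.span_singleton_prime (by exact_mod_cast hp.1.ne_zero)).mpr
      (Nat.prime_iff_prime_int.1 hp.1)).isMaximal (by simpa using hp.1.ne_zero)

theorem aux_stab (L : Type) [Field L] [NumberField L] [IsGalois ℚ L] (p : ℕ) [hp : Fact p.Prime]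
    (P : Ideal (𝓞 L)) [P.IsPrime] [hPl : P.LiesOver (Ideal.span {(p : ℤ)})]
    (hunram : Ideal.ramificationIdx' (Ideal.span {(p : ℤ)}) P = 1) :
    Function.Bijective (Ideal.Quotient.stabilizerHom P (Ideal.span {(p : ℤ)}) Gal(L/ℚ)) := by
  have hpm := aux_max p
  refine ⟨?_, Ideal.Quotient.stabilizerHom_surjective Gal(L/ℚ) _ _⟩
  rw [← MonoidHom.ker_eq_bot_iff]
  have h1 := Ideal.Quotient.map_ker_stabilizer_subtype P (Ideal.span {(p : ℤ)}) Gal(L/ℚ)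
  have h2 := Ideal.card_inertia_eq_ramificationIdxIn (G := Gal(L/ℚ)) (Ideal.span {(p : ℤ)}) P
  rw [Ideal.ramificationIdxIn_eq_ramificationIdx _ P Gal(L/ℚ), 
    ← Ideal.ramificationIdx'_eq_ramificationIdx (p := Ideal.span {(p : ℤ)}) _
      (by simpa using hp.1.ne_zero), hunram] at h2
  have h3 := Subgroup.eq_bot_of_card_eq _ h2
  rw [h3] at h1
  rwa [Subgroup.map_eq_bot_iff_of_injective _ (Subgroup.subtype_injective _)] at h1

theorem aux_norm_prod (L : Type) [Field L] [NumberField L] [IsGalois ℚ L] (x : 𝓞 L) :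
    ((Algebra.norm ℤ x : ℤ) : 𝓞 L) = ∏ g : Gal(L/ℚ), g • x := by
  apply NumberField.RingOfIntegers.coe_injective
  have := Algebra.norm_eq_prod_automorphisms ℚ (x : L)
  rw [← Algebra.coe_norm_int] at this
  simp at this
  simp [this]
  rfl

theorem aux_trace_sum (L : Type) [Field L] [NumberField L] [IsGalois ℚ L] (x : 𝓞 L) :
    ((Algebra.trace ℤ (𝓞 L) x : ℤ) : 𝓞 L) = ∑ g : Gal(L/ℚ), g • x := by
  apply NumberField.RingOfIntegers.coe_injective
  have := trace_eq_sum_automorphisms (K := ℚ) (x : L)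
  rw [← Algebra.coe_trace_int] at this
  simp at this
  simp [this]
  rfl

/-- An element congruent to `1` modulo `P` and to `0` modulo the other conjugates of `P`. -/
theorem aux_idem (L : Type) [Field L] [NumberField L] [IsGalois ℚ L]
    (P : Ideal (𝓞 L)) [hP : P.IsPrime] (hP0 : P ≠ ⊥) :
    ∃ e : 𝓞 L, e - 1 ∈ P ∧ ∀ g : Gal(L/ℚ), g ∉ MulAction.stabilizer Gal(L/ℚ) P → g • e ∈ P := by
  classical
  let s : Finset (Ideal (𝓞 L)) := Finset.univ.image (fun g : Gal(L/ℚ) => g • P)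
  obtain ⟨e, he⟩ := IsDedekindDomain.exists_forall_sub_mem_ideal (s := s) (fun Q => Q) (fun _ => 1)
    (by
      intro Q hQ
      obtain ⟨g, -, rfl⟩ := Finset.mem_image.1 hQ
      have h0 : g • P ≠ ⊥ := by
        intro h
        apply hP0
        have := congrArg (fun I => g⁻¹ • I) h
        simpa using this
      exact Ideal.prime_of_isPrime h0 inferInstance)
    (fun i _ j _ h => h) (fun Q => if (Q : Ideal (𝓞 L)) = P then 1 else 0)
  refine ⟨e, ?_, fun g hg => ?_⟩
  · simpa using he P (Finset.mem_image.2 ⟨1, by simp, by simp⟩)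
  · have hne : g⁻¹ • P ≠ P := by
      intro h
      apply hg
      have := (MulAction.stabilizer Gal(L/ℚ) P).inv_mem (MulAction.mem_stabilizer_iff.2 h)
      simpa using this
    have := he (g⁻¹ • P) (Finset.mem_image.2 ⟨g⁻¹, by simp, by simp⟩)
    simp only [hne, if_false, sub_zero, pow_one] at this
    rwa [Ideal.mem_inv_pointwise_smul_iff] at this

theorem aux_surj (L : Type) [Field L] [NumberField L] [IsGalois ℚ L] (p : ℕ) [hp : Fact p.Prime]
    (P : Ideal (𝓞 L)) [hPp : P.IsPrime] [hPl : P.LiesOver (Ideal.span {(p : ℤ)})]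
    (hunram : Ideal.ramificationIdx' (Ideal.span {(p : ℤ)}) P = 1) :
    (∀ c : ℤ, ∃ x : 𝓞 L, (p : ℤ) ∣ Algebra.norm ℤ x - c) ∧
    (∃ y : 𝓞 L, (p : ℤ) ∣ Algebra.trace ℤ (𝓞 L) y - 1) := by
  classical
  have hpm := aux_max p
  have hbij := aux_stab L p P hunram
  have hpP : ∀ c : ℤ, (c : 𝓞 L) ∈ P ↔ (p : ℤ) ∣ c := by
    intro c
    have h1 : (c : 𝓞 L) ∈ P ↔ c ∈ P.under ℤ := by simp [Ideal.under_def]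
    rw [h1, ← hPl.over, Ideal.mem_span_singleton]
  have hP0 : P ≠ ⊥ := by
    rintro rfl
    have := (hpP p).2 dvd_rfl
    simp [hp.1.ne_zero] at this
  have hPm : P.IsMaximal := hPp.isMaximal hP0
  obtain ⟨e, he1, he0⟩ := aux_idem L P hP0
  let p' := Ideal.span {(p : ℤ)}
  have : Finite (𝓞 L ⧸ P) := Ideal.finiteQuotientOfFreeOfNeBot P hP0
  have : Finite (ℤ ⧸ p') := Ideal.finiteQuotientOfFreeOfNeBot p' (by simpa [p'] using hp.1.ne_zero)
  have : IsGalois (ℤ ⧸ p') (𝓞 L ⧸ P) := inferInstance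
  have : FiniteDimensional (ℤ ⧸ p') (𝓞 L ⧸ P) := inferInstance
  have hcast : ∀ c : ℤ, algebraMap (ℤ ⧸ p') (𝓞 L ⧸ P) (Ideal.Quotient.mk p' c) = 
    Ideal.Quotient.mk P (c : 𝓞 L) := by
      intro c
      rw [Ideal.Quotient.algebraMap_mk_of_liesOver]
      simp
  have he1' : Ideal.Quotient.mk P e = 1 := by
    rw [← map_one (Ideal.Quotient.mk P), Ideal.Quotient.eq]; exact he1
  have hstab : ∀ (g : MulAction.stabilizer Gal(L/ℚ) P) (x : 𝓞 L),
    Ideal.Quotient.mk P ((g : Gal(L/ℚ)) • x) =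
      Ideal.Quotient.stabilizerHom P p' Gal(L/ℚ) g (Ideal.Quotient.mk P x) := by
    intro g x
    rfl
  constructor
  · intro c
    obtain ⟨zb, hzb⟩ := FiniteField.norm_surjective (ℤ ⧸ p') (𝓞 L ⧸ P) (Ideal.Quotient.mk p' c)
    obtain ⟨z, rfl⟩ := Ideal.Quotient.mk_surjective zb
    refine ⟨1 + e * (z - 1), ?_⟩
    rw [← hpP]
    push_cast
    rw [aux_norm_prod, ← Ideal.Quotient.eq, ← hcast, ← hzb, Algebra.norm_eq_prod_automorphisms,
      ← hbij.prod_comp, map_prod]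
    rw [← Finset.prod_subset (Finset.subset_univ (Finset.univ.filter (· ∈ MulAction.stabilizer Gal(L/ℚ) P)))]
    · rw [Finset.prod_subtype (p := (· ∈ MulAction.stabilizer Gal(L/ℚ) P)) _ (by simp)]
      refine Finset.prod_congr rfl fun g _ => ?_
      rw [hstab]
      congr 1
      simp [he1']
    · intro g _ hg
      have := he0 g (by simpa using hg)
      rw [← map_one (Ideal.Quotient.mk P), Ideal.Quotient.eq]
      simp [smul_add, smul_mul', Ideal.mul_mem_right _ _ this]
  · obtain ⟨zb, hzb⟩ := Algebra.trace_surjective (ℤ ⧸ p') (𝓞 L ⧸ P) (Ideal.Quotient.mk p' 1)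
    obtain ⟨z, rfl⟩ := Ideal.Quotient.mk_surjective zb
    refine ⟨e * z, ?_⟩
    rw [← hpP]
    rw [Int.cast_sub, aux_trace_sum, ← Ideal.Quotient.eq, ← hcast, ← hzb, trace_eq_sum_automorphisms,
      ← hbij.sum_comp, map_sum]
    rw [← Finset.sum_subset (Finset.subset_univ (Finset.univ.filter (· ∈ MulAction.stabilizer Gal(L/ℚ) P)))]
    · rw [Finset.sum_subtype (p := (· ∈ MulAction.stabilizer Gal(L/ℚ) P)) _ (by simp)]
      refine Finset.sum_congr rfl fun g _ => ?_
      rw [hstab]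
      congr 1
      simp [he1']
    · intro g _ hg
      have := he0 g (by simpa using hg)
      rw [← map_zero (Ideal.Quotient.mk P), Ideal.Quotient.eq]
      simp [smul_mul', Ideal.mul_mem_right _ _ this]

theorem aux_surjK (K L : Type) [Field K] [NumberField K] [Field L] [NumberField L] [IsGalois ℚ L]
    [Algebra K L] (p : ℕ)
    (h : (∀ c : ℤ, ∃ x : 𝓞 L, (p : ℤ) ∣ Algebra.norm ℤ x - c) ∧
    (∃ y : 𝓞 L, (p : ℤ) ∣ Algebra.trace ℤ (𝓞 L) y - 1)) :
    (∀ c : ℤ, ∃ x : 𝓞 K, (p : ℤ) ∣ Algebra.norm ℤ x - c) ∧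
    (∃ y : 𝓞 K, (p : ℤ) ∣ Algebra.trace ℤ (𝓞 K) y - 1) := by
  refine ⟨fun c => ?_, ?_⟩
  · obtain ⟨x, hx⟩ := h.1 c
    obtain ⟨z, hz⟩ : ∃ z : 𝓞 K, (z : K) = Algebra.norm K (x : L) :=
      ⟨⟨_, Algebra.isIntegral_norm K (NumberField.RingOfIntegers.isIntegral_coe x)⟩, rfl⟩
    refine ⟨z, ?_⟩
    convert hx using 2
    apply Int.cast_injective (α := ℚ)
    rw [Algebra.coe_norm_int, Algebra.coe_norm_int, hz]
    exact Algebra.norm_norm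
  · obtain ⟨y, hy⟩ := h.2
    obtain ⟨z, hz⟩ : ∃ z : 𝓞 K, (z : K) = Algebra.trace K L (y : L) :=
      ⟨⟨_, Algebra.isIntegral_trace (NumberField.RingOfIntegers.isIntegral_coe y)⟩, rfl⟩
    refine ⟨z, ?_⟩
    convert hy using 2
    apply Int.cast_injective (α := ℚ)
    rw [Algebra.coe_trace_int, Algebra.coe_trace_int, hz]
    exact Algebra.trace_trace _

end

section
open scoped Pointwise

theorem aux_f_dvd (F : Type) [Field F] [NumberField F] (p : ℕ) [hp : Fact p.Prime]
    (Q : Ideal (𝓞 F)) [hQ : Q.IsPrime] (hpQ : (p : 𝓞 F) ∈ Q) (j : ℕ)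
    (h : ∀ y : 𝓞 F, y ^ (p ^ j) - y ∈ Q) :
    ∃ f : ℕ, Nat.card (𝓞 F ⧸ Q) = p ^ f ∧ f ∣ j := by
  have hQ0 : Q ≠ ⊥ := by
    rintro rfl
    have : (p : 𝓞 F) = 0 := by simpa using hpQ
    exact hp.1.ne_zero (by exact_mod_cast this)
  have hQm : Q.IsMaximal := hQ.isMaximal hQ0
  let := Ideal.Quotient.field Q
  have : Finite (𝓞 F ⧸ Q) := Ideal.finiteQuotientOfFreeOfNeBot Q hQ0
  let := Fintype.ofFinite (𝓞 F ⧸ Q)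
  have hc : CharP (𝓞 F ⧸ Q) p := by
    rw [CharP.charP_iff_prime_eq_zero hp.1]
    have := Ideal.Quotient.eq_zero_iff_mem.2 hpQ
    simpa using this
  obtain ⟨f, -, hf⟩ := FiniteField.card (𝓞 F ⧸ Q) p
  refine ⟨f, by rw [Nat.card_eq_fintype_card, hf], ?_⟩
  have h1 : ∀ x : (𝓞 F ⧸ Q)ˣ, x ^ (p ^ j - 1) = 1 := by
    intro x
    obtain ⟨y, hy⟩ := Ideal.Quotient.mk_surjective (x : 𝓞 F ⧸ Q)
    have h2 := Ideal.Quotient.eq.2 (h y)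
    rw [map_pow, hy] at h2
    have h3 : x ^ (p ^ j) = x := Units.ext (by simpa using h2)
    have h4 : x ^ (p ^ j - 1) * x = 1 * x := by
      rw [← pow_succ, Nat.sub_add_cancel (Nat.one_le_pow _ _ hp.1.pos), h3, one_mul]
    exact mul_right_cancel h4
  rw [FiniteField.forall_pow_eq_one_iff, hf] at h1
  have h2 := Nat.pow_sub_one_gcd_pow_sub_one p f j
  rw [Nat.gcd_eq_left h1] at h2
  have h3 : p ^ (f : ℕ) = p ^ (Nat.gcd f j) := by
    have a1 := Nat.one_le_pow f p hp.1.pos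
    have a2 := Nat.one_le_pow (Nat.gcd f j) p hp.1.pos
    omega
  rw [Nat.gcd_eq_left_iff_dvd.symm]
  exact (Nat.pow_right_injective hp.1.two_le h3).symm

theorem aux_frob (L : Type) [Field L] [NumberField L] [IsGalois ℚ L] (p : ℕ) [hp : Fact p.Prime]
    (P : Ideal (𝓞 L)) [hPp : P.IsPrime] [hPl : P.LiesOver (Ideal.span {(p : ℤ)})] :
    ∃ σ : Gal(L/ℚ), ∀ x : 𝓞 L, σ • x - x ^ p ∈ P := by
  have hpP : (p : 𝓞 L) ∈ P := by
    have h1 : (p : ℤ) ∈ P.under ℤ := by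
      rw [← hPl.over]; exact Ideal.mem_span_singleton_self _
    simpa [Ideal.under_def] using h1
  have hP0 : P ≠ ⊥ := by
    rintro rfl
    have : (p : 𝓞 L) = 0 := by simpa using hpP
    exact hp.1.ne_zero (by exact_mod_cast this)
  have : Finite (𝓞 L ⧸ P) := Ideal.finiteQuotientOfFreeOfNeBot P hP0
  obtain ⟨σ, hσ⟩ := IsArithFrobAt.exists_of_isInvariant ℤ Gal(L/ℚ) P
  refine ⟨σ, fun x => ?_⟩
  have := hσ x
  rw [← hPl.over] at this
  have hc : Nat.card (ℤ ⧸ Ideal.span {(p : ℤ)}) = p := by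
    rw [Nat.card_congr (Int.quotientSpanEquivZMod p).toEquiv]
    simp
  rw [hc] at this
  exact this

theorem aux_frob_pow (L : Type) [Field L] [NumberField L] (p : ℕ)
    (P : Ideal (𝓞 L)) (σ : Gal(L/ℚ)) (hσ : ∀ x : 𝓞 L, σ • x - x ^ p ∈ P) (j : ℕ) (x : 𝓞 L) :
    σ ^ j • x - x ^ (p ^ j) ∈ P := by
  induction j generalizing x with
  | zero => simp
  | succ j ih =>
    have h1 := ih (σ • x)
    have h2 : (σ • x) ^ (p ^ j) - (x ^ p) ^ (p ^ j) ∈ P :=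
      P.mem_of_dvd (sub_dvd_pow_sub_pow _ _ _) (hσ x)
    have h3 := P.add_mem h1 h2
    rw [pow_succ σ, mul_smul, pow_succ' p, pow_mul]
    simpa using h3

theorem aux_f_dvd' (F L : Type) [Field F] [NumberField F] [Field L] [NumberField L] (p : ℕ) [hp : Fact p.Prime]
    (P : Ideal (𝓞 L)) [hP : P.IsPrime] (hpP : (p : 𝓞 L) ∈ P) (σ : Gal(L/ℚ))
    (hσ : ∀ x : 𝓞 L, σ • x - x ^ p ∈ P) (j : ℕ) (φ : F →+* L) (hφ : ∀ y, (σ ^ j) (φ y) = φ y) :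
    ∃ Q : Ideal (𝓞 F), Q.IsPrime ∧ (p : 𝓞 F) ∈ Q ∧ 
      ∃ f : ℕ, Nat.card (𝓞 F ⧸ Q) = p ^ f ∧ f ∣ j := by
  let ψ := NumberField.RingOfIntegers.mapRingHom φ
  have hQ : (P.comap ψ).IsPrime := inferInstance
  have hpQ : (p : 𝓞 F) ∈ P.comap ψ := by simpa [Ideal.mem_comap] using hpP
  refine ⟨P.comap ψ, hQ, hpQ, aux_f_dvd F p _ hpQ j fun y => ?_⟩
  rw [Ideal.mem_comap, map_sub, map_pow, ← neg_sub, neg_mem_iff]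
  have h1 := aux_frob_pow L p P σ hσ j (ψ y)
  have h2 : σ ^ j • ψ y = ψ y := by
    apply NumberField.RingOfIntegers.coe_injective
    exact hφ y
  rwa [h2] at h1

/-- The permutation action of the Galois group on embeddings. -/
def auxPerm (K L : Type) [Field K] [Field L] [Algebra ℚ K] [Algebra ℚ L] :
    Gal(L/ℚ) →* Equiv.Perm (K →ₐ[ℚ] L) where
  toFun σ :=
    { toFun := fun φ => (σ : L →ₐ[ℚ] L).comp φ
      invFun := fun φ => ((σ⁻¹ : Gal(L/ℚ)) : L →ₐ[ℚ] L).comp φ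
      left_inv := fun φ => by ext x; simp [AlgEquiv.aut_inv]
      right_inv := fun φ => by ext x; simp [AlgEquiv.aut_inv] }
  map_one' := by ext φ x; simp
  map_mul' σ τ := by ext φ x; simp

theorem auxPerm_apply (K L : Type) [Field K] [Field L] [Algebra ℚ K] [Algebra ℚ L] (σ : Gal(L/ℚ))
    (φ : K →ₐ[ℚ] L) (x : K) : auxPerm K L σ φ x = σ (φ x) := rfl

theorem auxPerm_injective (K L : Type) [Field K] [Field L] [Algebra ℚ K] [Algebra ℚ L] [Algebra K L]
    [IsScalarTower ℚ K L]
    (hcl : IntermediateField.normalClosure ℚ K L = ⊤) : Function.Injective (auxPerm K L) := by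
  rw [injective_iff_map_eq_one]
  intro σ hσ
  have h1 : IntermediateField.normalClosure ℚ K L ≤
      IntermediateField.fixedField (Subgroup.zpowers σ) := by
    rw [normalClosure_def, iSup_le_iff]
    intro φ
    rw [IntermediateField.le_iff_le, Subgroup.zpowers_le, IntermediateField.mem_fixingSubgroup_iff]
    rintro _ ⟨x, rfl⟩
    have := auxPerm_apply K L σ φ x
    rw [hσ] at this
    exact this.symm
  rw [hcl, IntermediateField.le_iff_le, Subgroup.zpowers_le,
    IntermediateField.mem_fixingSubgroup_iff] at h1
  ext x
  exact h1 x trivial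

theorem aux_exists_P (ℓ : ℕ) (hℓ : ℓ.Prime)
    (K : Type) [Field K] [NumberField K]
    (hKdeg : Module.finrank ℚ K = ℓ)
    (hKnotGal : ¬ IsGalois ℚ K)
    (L : Type) [Field L] [NumberField L] [Algebra K L] [IsGalois ℚ L]
    (hLclosure : IntermediateField.normalClosure ℚ K L = ⊤)
    (q : ℕ) (hq : q.Prime)
    (k : IntermediateField ℚ L)
    (hkGal : IsGalois ℚ k)
    (hkdeg : Module.finrank ℚ k = q)
    (p : ℕ) [hp : Fact p.Prime]
    (P : Ideal (𝓞 L)) [hPp : P.IsPrime] [hPl : P.LiesOver (Ideal.span {(p : ℤ)})]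
    (hinert : (Ideal.span {(p : 𝓞 k)}).IsPrime) :
    ∃ Q : Ideal (𝓞 K), Q.IsPrime ∧ (p : 𝓞 K) ∈ Q ∧ 
      ∃ f : ℕ, Nat.card (𝓞 K ⧸ Q) = p ^ f ∧ ¬ ℓ ∣ f := by
  classical
  have hpP : (p : 𝓞 L) ∈ P := by
    have h1 : (p : ℤ) ∈ P.under ℤ := by
      rw [← hPl.over]; exact Ideal.mem_span_singleton_self _
    simpa [Ideal.under_def] using h1
  obtain ⟨σ, hσ⟩ := aux_frob L p P
  by_contra! hcon
  have key : ∀ (φ : K →ₐ[ℚ] L) (j : ℕ), (auxPerm K L σ ^ j) φ = φ → ℓ ∣ j := by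
    intro φ j hj
    obtain ⟨Q, hQ, hpQ, f, hf, hfj⟩ := aux_f_dvd' K L p P hpP σ hσ j φ (fun y => by
      rw [← map_pow] at hj
      have := auxPerm_apply K L (σ ^ j) φ y
      rw [hj] at this
      exact this.symm)
    exact (hcon Q hQ hpQ f hf).trans hfj
  have hcard : Nat.card (K →ₐ[ℚ] L) ≤ ℓ := hKdeg ▸ card_algHom_le_finrank ℚ K L
  have hσℓ : σ ^ ℓ = 1 := by
    apply auxPerm_injective K L hLclosure
    rw [map_one, map_pow]
    ext1 φ
    rw [Equiv.Perm.one_apply]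
    have hni : ¬ Function.Injective (fun i : Fin (ℓ + 1) => (auxPerm K L σ ^ (i : ℕ)) φ) := by
      intro hi
      have := Nat.card_le_card_of_injective _ hi
      rw [Nat.card_fin] at this
      omega
    simp only [Function.Injective, not_forall] at hni
    obtain ⟨a, b, hab, hne⟩ := hni
    have main : ∀ a b : Fin (ℓ + 1), a < b →
        (auxPerm K L σ ^ (a : ℕ)) φ = (auxPerm K L σ ^ (b : ℕ)) φ →
        (auxPerm K L σ ^ ℓ) φ = φ := by
      intro a b hlt hab
      have hlt' : (a : ℕ) < b := hlt
      have h1 : (auxPerm K L σ ^ ((b : ℕ) - a)) φ = φ := by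
        apply (auxPerm K L σ ^ (a : ℕ)).injective
        rw [← Equiv.Perm.mul_apply, ← pow_add, Nat.add_sub_cancel' hlt'.le, hab]
      have h2 := key φ _ h1
      have h3 : (b : ℕ) - a = ℓ := by
        have := Nat.le_of_dvd (by omega) h2
        have := b.2
        omega
      rwa [h3] at h1
    rcases lt_or_gt_of_ne hne with h | h
    · exact main a b h hab
    · exact main b a h hab.symm
  have hkN : NumberField k := inferInstance
  have hσk : AlgEquiv.restrictNormalHom k σ ≠ 1 := by
    intro h
    obtain ⟨Q, hQ, hpQ, f, hf, hfj⟩ := aux_f_dvd' k L p P hpP σ hσ 1 (algebraMap k L) (fun y => by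
      have := AlgEquiv.restrictNormal_commutes σ k y
      rw [pow_one, ← this]
      congr 1
      exact DFunLike.congr_fun h y)
    have hp0 : Ideal.span {(p : 𝓞 k)} ≠ ⊥ := by
      simpa using hp.1.ne_zero
    have hm : (Ideal.span {(p : 𝓞 k)}).IsMaximal := hinert.isMaximal hp0
    have hQe : Ideal.span {(p : 𝓞 k)} = Q := hm.eq_of_le hQ.ne_top (by
      rwa [Ideal.span_singleton_le_iff_mem])
    have h1 := Ideal.absNorm_span_natCast (S := 𝓞 k) p
    have h4 : Module.finrank ℤ (𝓞 k) = q := by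
      rw [NumberField.RingOfIntegers.rank, ← hkdeg]
    rw [hQe, Ideal.absNorm_apply, Submodule.cardQuot_apply, h4] at h1
    have h2 : p ^ f = p ^ q := hf.symm.trans h1
    have h3 := Nat.pow_right_injective hp.1.two_le h2
    rw [h3] at hfj
    exact hq.one_lt.ne' (Nat.dvd_one.1 hfj)
  have hqℓ : q = ℓ := by
    by_contra hne
    apply hσk
    have hcop := (Nat.coprime_primes hq hℓ).2 hne
    have h1 : (AlgEquiv.restrictNormalHom k σ) ^ ℓ = 1 := by rw [← map_pow, hσℓ, map_one]
    have h2 : (AlgEquiv.restrictNormalHom k σ) ^ q = 1 := by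
      rw [← hkdeg, ← IsGalois.card_aut_eq_finrank]
      exact pow_card_eq_one'
    have h3 := Nat.dvd_gcd (orderOf_dvd_of_pow_eq_one h2) (orderOf_dvd_of_pow_eq_one h1)
    rw [hcop] at h3
    exact orderOf_eq_one_iff.1 (Nat.dvd_one.1 h3)
  subst hqℓ
  have hG : Nat.card Gal(L/ℚ) ∣ q.factorial := by
    have h1 := Subgroup.card_dvd_of_injective _ (auxPerm_injective K L hLclosure)
    rw [Nat.card_perm] at h1
    exact h1.trans (Nat.factorial_dvd_factorial hcard)
  let K' := (IsScalarTower.toAlgHom ℚ K L).fieldRange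
  let e : K ≃ₐ[ℚ] K' := AlgEquiv.ofInjectiveField (IsScalarTower.toAlgHom ℚ K L)
  have hK'deg : Module.finrank ℚ K' = q := by
    rw [← hKdeg]; exact e.toLinearEquiv.finrank_eq.symm
  have hH : K'.fixingSubgroup.index = q := by
    rw [← IntermediateField.finrank_eq_fixingSubgroup_index, hK'deg]
  have hN : k.fixingSubgroup.index = q := by
    rw [← IntermediateField.finrank_eq_fixingSubgroup_index, hkdeg]
  have hnor : k.fixingSubgroup.Normal := by
    have hkG' : @IsGalois ℚ _ k _ (IntermediateField.algebra' k) := by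
      convert hkGal
      exact Subsingleton.elim _ _
    have hkn := hkG'.to_normal
    rw [← IntermediateField.restrictNormalHom_ker k]
    infer_instance
  rcases (Nat.dvd_prime hq).1 (hN ▸ k.fixingSubgroup.relIndex_dvd_index_of_normal K'.fixingSubgroup)
    with h | h
  · rw [Subgroup.relIndex_eq_one, ← IntermediateField.le_iff_le,
      IsGalois.fixedField_fixingSubgroup] at h
    have hkK : k = K' := IntermediateField.eq_of_le_of_finrank_eq h (hkdeg.trans hK'deg.symm)
    apply hKnotGal
    rw [hkK] at hkGal
    exact IsGalois.of_algEquiv e.symm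
  · have h1 := Subgroup.relIndex_mul_index (inf_le_right : k.fixingSubgroup ⊓ K'.fixingSubgroup ≤ _)
    rw [Subgroup.inf_relIndex_right, h, hH] at h1
    have h2 : q * q ∣ q.factorial := by
      rw [h1]
      exact (Subgroup.index_dvd_card _).trans hG
    obtain ⟨m, rfl⟩ : ∃ m, q = m + 1 := ⟨q - 1, by have := hq.pos; omega⟩
    rw [Nat.factorial_succ] at h2
    have h3 := Nat.dvd_of_mul_dvd_mul_left (Nat.succ_pos m) h2
    have := (hq.dvd_factorial).1 h3
    omega

end

theorem aux_main (ℓ : ℕ) (hℓ : ℓ.Prime)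
    (K : Type) [Field K] [NumberField K]
    (hKdeg : Module.finrank ℚ K = ℓ)
    (hKnotGal : ¬ IsGalois ℚ K)
    (L : Type) [Field L] [NumberField L] [Algebra K L] [IsGalois ℚ L]
    (hLclosure : IntermediateField.normalClosure ℚ K L = ⊤)
    (q : ℕ) (hq : q.Prime)
    (k : IntermediateField ℚ L)
    (hkGal : IsGalois ℚ k)
    (hkdeg : Module.finrank ℚ k = q)
    (a : ℚ) (ha : a ≠ 0)
    (p : ℕ) [hp : Fact p.Prime]
    (hunram : ∀ P : Ideal (𝓞 L), P.IsPrime → (p : 𝓞 L) ∈ P →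
      Ideal.ramificationIdx' (Ideal.span {(p : ℤ)}) P = 1)
    (hinert : (Ideal.span {(p : 𝓞 k)}).IsPrime) :
    ∃ x : ℚ_[p] ⊗[ℚ] K, Algebra.norm ℚ_[p] x = (a : ℚ_[p]) := by
  have hpm := aux_max p
  obtain ⟨P, hPm, hPl⟩ := Ideal.exists_maximal_ideal_liesOver_of_isIntegral
    (S := 𝓞 L) (Ideal.span {(p : ℤ)})
  have hPp : P.IsPrime := hPm.isPrime
  have hpP : (p : 𝓞 L) ∈ P := by
    have h1 : (p : ℤ) ∈ P.under ℤ := by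
      rw [← hPl.over]; exact Ideal.mem_span_singleton_self _
    simpa [Ideal.under_def] using h1
  obtain ⟨Q, hQ, hpQ, f, hf, hlf⟩ := aux_exists_P ℓ hℓ K hKdeg hKnotGal L hLclosure q hq k hkGal
    hkdeg p P hinert
  obtain ⟨hs, y, hy⟩ := aux_surjK K L p (aux_surj L p P (hunram P hPp hpP))
  refine aux_final K p (aux_val K p ℓ hℓ hKdeg Q hpQ f hf hlf) (aux_norm K p) (fun u hu => ?_) a ha
  obtain ⟨n, -, hn⟩ := PadicInt.exists_mem_range (p := p) u
  obtain ⟨x0, hx0⟩ := hs n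
  refine aux_hensel K p x0 y u hu ?_ ?_
  · rw [← PadicInt.norm_int_lt_one_iff_dvd] at hx0
    have hn' : ‖u - (n : ℤ_[p])‖ < 1 := PadicInt.mem_nonunits.1 ((IsLocalRing.mem_maximalIdeal _).1 hn)
    have h2 : (Algebra.norm ℤ x0 : ℤ_[p]) - u =
        ((Algebra.norm ℤ x0 - (n : ℤ) : ℤ) : ℤ_[p]) + -(u - (n : ℤ_[p])) := by push_cast; ring
    rw [h2]
    refine (PadicInt.nonarchimedean _ _).trans_lt (max_lt hx0 ?_)
    rwa [norm_neg]
  · intro h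
    have h3 : (p : ℤ) ∣ 1 := (Int.dvd_iff_dvd_of_dvd_sub hy).1 h
    have := Int.natCast_dvd_natCast.1 (by exact_mod_cast h3 : (p : ℤ) ∣ ((1 : ℕ) : ℤ))
    exact hp.1.one_lt.ne' (Nat.dvd_one.1 this)

/-- Lemma 2: let `ℓ` be a prime, `K/ℚ` a non-Galois number field of degree `ℓ`, `L` its
normal closure, and `k ⊆ L` a cyclic subextension of `ℚ` of prime degree `q`.  If `a ∈ ℚ^×`
and `p` is a prime that is unramified in `L` and inert in `k`, then `a` is a norm from the
`ℚ_p`-algebra `K ⊗_ℚ ℚ_p`. -/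
theorem lemma_le2
    (ℓ : ℕ) (hℓ : ℓ.Prime)
    (K : Type) [Field K] [Algebra ℚ K] [FiniteDimensional ℚ K]
    (hKdeg : Module.finrank ℚ K = ℓ)
    (hKnotGal : ¬ IsGalois ℚ K)
    (L : Type) [Field L] [Algebra ℚ L] [Algebra K L] [IsScalarTower ℚ K L]
    [FiniteDimensional ℚ L]
    (hLGal : IsGalois ℚ L)
    (hLclosure : IntermediateField.normalClosure ℚ K L = ⊤)
    (q : ℕ) (hq : q.Prime)
    (k : IntermediateField ℚ L)
    (hkGal : IsGalois ℚ k) (hkcyc : IsCyclic (k ≃ₐ[ℚ] k))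
    (hkdeg : Module.finrank ℚ k = q)
    (a : ℚ) (ha : a ≠ 0)
    (p : ℕ) [Fact p.Prime]
    (hunram : ∀ P : Ideal (𝓞 L), P.IsPrime → (p : 𝓞 L) ∈ P →
      Ideal.ramificationIdx' (Ideal.span {(p : ℤ)}) P = 1)
    (hinert : (Ideal.span {(p : 𝓞 k)}).IsPrime) :
    ∃ x : ℚ_[p] ⊗[ℚ] K, Algebra.norm ℚ_[p] x = (a : ℚ_[p]) := by
  have c1 : CharZero K := algebraRat.charZero K
  have c2 : CharZero L := algebraRat.charZero L
  have e1 : ‹Algebra ℚ K› = @DivisionRing.toRatAlgebra K _ c1 := Subsingleton.elim _ _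
  have e2 : ‹Algebra ℚ L› = @DivisionRing.toRatAlgebra L _ c2 := Subsingleton.elim _ _
  subst e1 e2
  have n1 : NumberField K := { to_charZero := c1, to_finiteDimensional := inferInstance }
  have n2 : NumberField L := { to_charZero := c2, to_finiteDimensional := inferInstance }
  exact aux_main ℓ hℓ K hKdeg hKnotGal L hLclosure q hq k hkGal hkdeg a ha p hunram hinert
end

section
/- Let ℓ be a prime number and let K be a number field with [K:ℚ] = ℓ such that K/ℚ is not a Galois extension. Let L be the normal closure of K over ℚ (inside a fixed algebraic closure of ℚ), and let k ⊆ L be a subfield such that k/ℚ is a cyclic Galois extension of prime degree q with q < ℓ. If p is a prime number that is unramified in L (every prime ideal of the ring of integers of L above p has ramification index 1) and inert in k (the ideal generated by p in the ring of integers of k is a prime ideal), then the ℚ_p-algebra K ⊗_ℚ ℚ_p is not a field. -/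
open scoped TensorProduct NumberField

lemma aux_perm {α : Type*} [Fintype α] [DecidableEq α] (ℓ q : ℕ) (hℓ : ℓ.Prime) (hq : q.Prime)
    (hqℓ : q < ℓ) (hc : Fintype.card α ≤ ℓ) (σ : Equiv.Perm α) (h1 : ℓ ∣ orderOf σ)
    (h2 : q ∣ orderOf σ) : False := by
  have key : ∃ c ∈ σ.cycleType, ℓ ∣ c := by
    by_contra! hcon
    rw [← Equiv.Perm.lcm_cycleType] at h1
    have : ∀ s : Multiset ℕ, (∀ c ∈ s, ¬ ℓ ∣ c) → ¬ ℓ ∣ s.lcm := by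
      intro s
      induction s using Multiset.induction with
      | empty => intro _ h; simp at h; exact hℓ.one_lt.ne' h
      | cons a s ih =>
        intro hs h
        rw [Multiset.lcm_cons] at h
        have : ℓ ∣ a * s.lcm := h.trans (lcm_dvd (dvd_mul_right _ _) (dvd_mul_left _ _))
        rcases hℓ.dvd_mul.1 this with h | h
        · exact hs a (by simp) h
        · exact ih (fun c hc => hs c (by simp [hc])) h
    exact this _ hcon h1
  obtain ⟨c, hcm, hd⟩ := key
  obtain ⟨t, ht⟩ := Multiset.exists_cons_of_mem hcm
  have hs := σ.sum_cycleType_le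
  rw [ht, Multiset.sum_cons] at hs
  have hcpos : 0 < c := by
    have := Equiv.Perm.one_lt_of_mem_cycleType hcm
    omega
  have hle := Nat.le_of_dvd hcpos hd
  have ht0 : t = 0 := by
    apply Multiset.eq_zero_of_forall_notMem
    intro a ha
    have h3 : 1 < a := Equiv.Perm.one_lt_of_mem_cycleType (σ := σ) (by rw [ht]; simp [ha])
    have h4 := Multiset.single_le_sum (fun _ _ => Nat.zero_le _) a ha
    omega
  have hcl : c = ℓ := by omega
  rw [← Equiv.Perm.lcm_cycleType, ht, ht0, hcl] at h2
  simp at h2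
  exact hqℓ.ne ((Nat.prime_dvd_prime_iff_eq hq hℓ).1 h2)

lemma aux_norm_s12 (p : ℕ) [Fact p.Prime] (F : Type*) [Field F] [Algebra ℚ_[p] F]
    [FiniteDimensional ℚ_[p] F] (y : F) :
    ‖Algebra.norm ℚ_[p] y‖ < 1 ↔ spectralNorm ℚ_[p] F y < 1 := by
  have hy : IsIntegral ℚ_[p] y := Algebra.IsIntegral.isIntegral y
  have hg : ‖Algebra.norm ℚ_[p] (IntermediateField.AdjoinSimple.gen ℚ_[p] y)‖ =
      ‖(minpoly ℚ_[p] y).coeff 0‖ := by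
    have := Algebra.PowerBasis.norm_gen_eq_coeff_zero_minpoly
      (IntermediateField.adjoin.powerBasis hy)
    rw [IntermediateField.adjoin.powerBasis_gen] at this
    rw [this, norm_mul, norm_pow, norm_neg, norm_one, one_pow, one_mul,
      IntermediateField.minpoly_gen]
  have hn : (minpoly ℚ_[p] y).natDegree ≠ 0 := (minpoly.natDegree_pos hy).ne'
  rw [Algebra.norm_eq_norm_adjoin, norm_pow, hg, spectralNorm.spectralNorm_eq_norm_coeff_zero_rpow,
    pow_lt_one_iff_of_nonneg (norm_nonneg _) Module.finrank_pos.ne']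
  rw [Real.rpow_lt_one_iff' (norm_nonneg _) (by positivity)]

lemma aux_add (p : ℕ) [Fact p.Prime] (F : Type*) [Field F] [Algebra ℚ_[p] F]
    [FiniteDimensional ℚ_[p] F] (y z : F) (hy : ‖Algebra.norm ℚ_[p] y‖ < 1)
    (hz : ‖Algebra.norm ℚ_[p] z‖ < 1) : ‖Algebra.norm ℚ_[p] (y + z)‖ < 1 := by
  rw [aux_norm_s12] at *
  exact (isNonarchimedean_spectralNorm y z).trans_lt (max_lt hy hz)

lemma aux_baseChange (p : ℕ) [Fact p.Prime] (K : Type*) [Field K] [Algebra ℚ K]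
    [FiniteDimensional ℚ K] (x : K) :
    Algebra.norm ℚ_[p] ((1 : ℚ_[p]) ⊗ₜ[ℚ] x) = ((Algebra.norm ℚ x : ℚ) : ℚ_[p]) := by
  have := LinearMap.det_baseChange (A := ℚ_[p]) (f := Algebra.lmul ℚ K x)
  rw [Algebra.norm_apply, Algebra.norm_apply]
  rw [eq_ratCast] at this
  rw [← this]
  congr 1
  ext; simp

lemma aux_lies (p : ℕ) [Fact p.Prime] (K : Type*) [Field K] [NumberField K]
    (I : Ideal (𝓞 K)) (hI : I.IsPrime) (hpI : (p : 𝓞 K) ∈ I) :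
    I.LiesOver (Ideal.span {(p : ℤ)}) := by
  have : (Ideal.span {(p : ℤ)}).IsMaximal := Int.ideal_span_isMaximal_of_prime p
  refine ⟨this.eq_of_le (Ideal.IsPrime.under ℤ I).ne_top ?_⟩
  rw [Ideal.span_singleton_le_iff_mem, Ideal.mem_comap]
  simpa using hpI

lemma aux_unique (p : ℕ) [Fact p.Prime] (K : Type*) [Field K] [NumberField K]
    (h : IsField (ℚ_[p] ⊗[ℚ] K)) (P Q : Ideal (𝓞 K)) (hP : P.IsPrime) (hQ : Q.IsPrime)
    (hpP : (p : 𝓞 K) ∈ P) (hpQ : (p : 𝓞 K) ∈ Q) : P = Q := by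
  have hadd : ∀ x y : 𝓞 K, (p : ℤ) ∣ Algebra.norm ℤ x → (p : ℤ) ∣ Algebra.norm ℤ y →
      (p : ℤ) ∣ Algebra.norm ℤ (x + y) := by
    intro x y hx hy
    have key : ∀ x : 𝓞 K, (p : ℤ) ∣ Algebra.norm ℤ x ↔
      ‖Algebra.norm ℚ_[p] ((1 : ℚ_[p]) ⊗ₜ[ℚ] (x : K))‖ < 1 := by
      intro x
      rw [aux_baseChange, ← Algebra.coe_norm_int, ← Padic.norm_intCast_lt_one_iff]
      simp
    rw [key] at *
    let := h.toField
    have := aux_add p (ℚ_[p] ⊗[ℚ] K) _ _ hx hy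
    rw [← TensorProduct.tmul_add] at this
    exact_mod_cast this
  have hdvd : ∀ (I : Ideal (𝓞 K)), I.IsPrime → (p : 𝓞 K) ∈ I → ∀ x ∈ I,
      (p : ℤ) ∣ Algebra.norm ℤ x := by
    intro I hI hpI x hx
    refine dvd_trans ?_ (Int.dvd_trans (Int.natCast_dvd_natCast.mpr dvd_rfl)
      (Ideal.absNorm_dvd_norm_of_mem hx))
    have : I.LiesOver (Ideal.span {(p : ℤ)}) := aux_lies p K I hI hpI
    rw [← Ideal.pow_inertiaDeg p I]
    push_cast
    exact dvd_pow_self _ (Ideal.inertiaDeg_pos I ℤ).ne'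
  by_contra hne
  have hp0 : (p : 𝓞 K) ≠ 0 := by exact_mod_cast (Fact.out : p.Prime).ne_zero
  have hPm : P.IsMaximal := hP.isMaximal (fun h0 => hp0 (by simpa [h0] using hpP))
  have hQm : Q.IsMaximal := hQ.isMaximal (fun h0 => hp0 (by simpa [h0] using hpQ))
  have hsup : P ⊔ Q = ⊤ := hPm.coprime_of_ne hQm hne
  have h1 : (1 : 𝓞 K) ∈ P ⊔ Q := by rw [hsup]; trivial
  obtain ⟨x, hx, y, hy, hxy⟩ := Submodule.mem_sup.1 h1
  have := hadd x y (hdvd P hP hpP x hx) (hdvd Q hQ hpQ y hy)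
  rw [hxy, map_one] at this
  exact (Nat.prime_iff_prime_int.1 (Fact.out : p.Prime)).not_dvd_one this

lemma aux_dvd (p : ℕ) [Fact p.Prime] (K L : Type*) [Field K] [NumberField K]
    [Field L] [NumberField L] [Algebra K L] (P : Ideal (𝓞 L)) (hP : P.IsPrime)
    (hpP : (p : 𝓞 L) ∈ P) (hram : Ideal.ramificationIdx' (Ideal.span {(p : ℤ)}) P = 1)
    (huniq : ∀ I J : Ideal (𝓞 K), I.IsPrime → J.IsPrime → (p : 𝓞 K) ∈ I → (p : 𝓞 K) ∈ J → I = J) :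
    Module.finrank ℚ K ∣ P.inertiaDeg ℤ := by
  have hmax : (Ideal.span {(p : ℤ)}).IsMaximal := Int.ideal_span_isMaximal_of_prime p
  have hp0 : Ideal.span {(p : ℤ)} ≠ ⊥ := by
    simp [(Fact.out : p.Prime).ne_zero]
  have hl := aux_lies p L P hP hpP
  rw [Ideal.ramificationIdx'_eq_ramificationIdx _ _ hp0] at hram
  have hI : (P.under (𝓞 K)).IsPrime := inferInstance
  have hpI : (p : 𝓞 K) ∈ P.under (𝓞 K) := by
    rw [Ideal.mem_comap]; simpa using hpP
  have hIl := aux_lies p K _ hI hpI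
  have he : (P.under (𝓞 K)).ramificationIdx ℤ = 1 :=
    Nat.dvd_one.1 (hram ▸ Ideal.ramificationIdx_below_dvd (R := ℤ) (P.under (𝓞 K)) P)
  have : Finite ((Ideal.span {(p : ℤ)}).primesOver (𝓞 K)) :=
    IsDedekindDomain.primesOver_finite (Ideal.span {(p : ℤ)}) (𝓞 K)
  let := Fintype.ofFinite ((Ideal.span {(p : ℤ)}).primesOver (𝓞 K))
  have := Ideal.sum_ramification_inertia_eq_finrank (Ideal.span {(p : ℤ)}) (𝓞 K)
  rw [Finset.sum_eq_single ⟨P.under (𝓞 K), hI, hIl⟩, he, one_mul, NumberField.RingOfIntegers.rank] at this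
  · rw [← this]
    exact Ideal.inertiaDeg_below_dvd (R := ℤ) (P.under (𝓞 K)) P
  · rintro ⟨J, hJ, hJl⟩ _ hne
    refine absurd (Subtype.ext (huniq _ _ hJ hI ?_ hpI)) hne
    have : (p : ℤ) ∈ J.under ℤ := by
      rw [← hJl.over]; exact Ideal.mem_span_singleton_self _
    simpa [Ideal.mem_comap] using this
  · simp

lemma aux_frob_s12 (p : ℕ) [Fact p.Prime] (L : Type*) [Field L] [NumberField L] [IsGalois ℚ L]
    (P : Ideal (𝓞 L)) (hP : P.IsPrime) (hpP : (p : 𝓞 L) ∈ P) :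
    ∃ σ : L ≃ₐ[ℚ] L, P.inertiaDeg ℤ ∣ orderOf σ := by
  have hmax : (Ideal.span {(p : ℤ)}).IsMaximal := Int.ideal_span_isMaximal_of_prime p
  have hl := aux_lies p L P hP hpP
  have hp0 : (p : 𝓞 L) ≠ 0 := by exact_mod_cast (Fact.out : p.Prime).ne_zero
  have hPm : P.IsMaximal := hP.isMaximal (fun h0 => hp0 (by simpa [h0] using hpP))
  rw [Ideal.inertiaDeg_eq_of_isMaximal (Ideal.span {(p : ℤ)})]
  let := Ideal.Quotient.field P
  let := Ideal.Quotient.field (Ideal.span {(p : ℤ)})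
  have : Finite (𝓞 L ⧸ P) := inferInstance
  have : Finite (ℤ ⧸ Ideal.span {(p : ℤ)}) :=
    Ideal.finiteQuotientOfFreeOfNeBot _ (by simp [(Fact.out : p.Prime).ne_zero])
  let := Fintype.ofFinite (ℤ ⧸ Ideal.span {(p : ℤ)})
  obtain ⟨g, hg⟩ := Ideal.Quotient.stabilizerHom_surjective (L ≃ₐ[ℚ] L) (Ideal.span {(p : ℤ)}) P
    (FiniteField.frobeniusAlgEquivOfAlgebraic _ _)
  refine ⟨g, ?_⟩
  rw [← FiniteField.orderOf_frobeniusAlgEquivOfAlgebraic, ← hg]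
  rw [Subgroup.orderOf_coe]
  exact orderOf_map_dvd _ _

lemma aux_faithful (K L : Type*) [Field K] [Algebra ℚ K] [FiniteDimensional ℚ K]
    [Field L] [Algebra ℚ L] (hc : IntermediateField.normalClosure ℚ K L = ⊤)
    (ℓ q : ℕ) (hℓ : ℓ.Prime) (hq : q.Prime) (hqℓ : q < ℓ) (hd : Module.finrank ℚ K = ℓ)
    (σ : L ≃ₐ[ℚ] L) (h1 : ℓ ∣ orderOf σ) (h2 : q ∣ orderOf σ) : False := by
  classical
  let := Fintype.ofFinite (K →ₐ[ℚ] L)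
  let φ : (L ≃ₐ[ℚ] L) →* Equiv.Perm (K →ₐ[ℚ] L) :=
    { toFun := fun s =>
        { toFun := fun f => (s : L →ₐ[ℚ] L).comp f
          invFun := fun f => ((s⁻¹ : L ≃ₐ[ℚ] L) : L →ₐ[ℚ] L).comp f
          left_inv := fun f => by ext x; exact s.symm_apply_apply (f x)
          right_inv := fun f => by ext x; exact s.apply_symm_apply (f x) }
      map_one' := by ext; rfl
      map_mul' := fun s t => by ext; rfl }
  have hφ : Function.Injective φ := by
    rw [injective_iff_map_eq_one]
    intro s hs
    have hle : IntermediateField.normalClosure ℚ K L ≤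
        IntermediateField.fixedField (Subgroup.zpowers s) := by
      rw [normalClosure_le_iff]
      rintro f _ ⟨x, rfl⟩
      have hsx : s (f x) = f x := DFunLike.congr_fun (DFunLike.congr_fun hs f) x
      rw [IntermediateField.mem_fixedField_iff]
      intro t ht
      have : Subgroup.zpowers s ≤ MulAction.stabilizer (L ≃ₐ[ℚ] L) (f x) := by
        rw [Subgroup.zpowers_le]
        exact hsx
      exact this ht
    rw [hc] at hle
    ext x
    exact (IntermediateField.mem_fixedField_iff _ _).1 (hle (IntermediateField.mem_top (x := x)))
      s (Subgroup.mem_zpowers s)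
  rw [← orderOf_injective φ hφ] at h1 h2
  refine aux_perm ℓ q hℓ hq hqℓ ?_ (φ σ) h1 h2
  rw [← hd, ← Nat.card_eq_fintype_card]
  exact card_algHom_le_finrank ℚ K L

/-- Let `ℓ` be a prime, `K/ℚ` a non-Galois number field of degree `ℓ`, `L` its normal
closure, and `k ⊆ L` a cyclic subextension of `ℚ` of prime degree `q < ℓ`.  If `p` is a
prime that is unramified in `L` and inert in `k`, then the `ℚ_p`-algebra `K ⊗_ℚ ℚ_p` is
not a field. -/
theorem tensor_not_field_of_unramified_inert
    (ℓ : ℕ) (hℓ : ℓ.Prime)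
    (K : Type) [Field K] [Algebra ℚ K] [FiniteDimensional ℚ K]
    (hKdeg : Module.finrank ℚ K = ℓ)
    (hKnotGal : ¬ IsGalois ℚ K)
    (L : Type) [Field L] [Algebra ℚ L] [Algebra K L] [IsScalarTower ℚ K L]
    [FiniteDimensional ℚ L]
    (hLGal : IsGalois ℚ L)
    (hLclosure : IntermediateField.normalClosure ℚ K L = ⊤)
    (q : ℕ) (hq : q.Prime) (hqℓ : q < ℓ)
    (k : IntermediateField ℚ L)
    (hkGal : IsGalois ℚ k) (hkcyc : IsCyclic (k ≃ₐ[ℚ] k))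
    (hkdeg : Module.finrank ℚ k = q)
    (p : ℕ) [Fact p.Prime]
    (hunram : ∀ P : Ideal (𝓞 L), P.IsPrime → (p : 𝓞 L) ∈ P →
      Ideal.ramificationIdx' (Ideal.span {(p : ℤ)}) P = 1)
    (hinert : (Ideal.span {(p : 𝓞 k)}).IsPrime) :
    ¬ IsField (ℚ_[p] ⊗[ℚ] K) := by
  intro hfield
  have cK : CharZero K := algebraRat.charZero K
  have cL : CharZero L := algebraRat.charZero L
  obtain rfl : ‹Algebra ℚ K› = DivisionRing.toRatAlgebra := Subsingleton.elim _ _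
  obtain rfl : ‹Algebra ℚ L› = DivisionRing.toRatAlgebra := Subsingleton.elim _ _
  have nK : NumberField K := { }
  have nL : NumberField L := { }
  have nk : NumberField k := inferInstance
  have hmax : (Ideal.span {(p : ℤ)}).IsMaximal := Int.ideal_span_isMaximal_of_prime p
  obtain ⟨P, hPm, hPl⟩ := Ideal.exists_maximal_ideal_liesOver_of_isIntegral
    (S := 𝓞 L) (Ideal.span {(p : ℤ)})
  have hpP : (p : 𝓞 L) ∈ P := by
    have : (p : ℤ) ∈ P.under ℤ := by
      rw [← hPl.over]; exact Ideal.mem_span_singleton_self _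
    simpa [Ideal.mem_comap] using this
  have hram := hunram P hPm.isPrime hpP
  have h1 : Module.finrank ℚ K ∣ P.inertiaDeg ℤ :=
    aux_dvd p K L P hPm.isPrime hpP hram (fun I J hI hJ h h' => aux_unique p K hfield I J hI hJ h h')
  have h2 : Module.finrank ℚ k ∣ P.inertiaDeg ℤ := by
    have hp0 : (p : 𝓞 k) ≠ 0 := by exact_mod_cast (Fact.out : p.Prime).ne_zero
    have hm : (Ideal.span {(p : 𝓞 k)}).IsMaximal := hinert.isMaximal (by simpa using hp0)
    have hu : ∀ I : Ideal (𝓞 k), I.IsPrime → (p : 𝓞 k) ∈ I → Ideal.span {(p : 𝓞 k)} = I :=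
      fun I hI h => hm.eq_of_le hI.ne_top ((Ideal.span_singleton_le_iff_mem I).2 h)
    convert aux_dvd p k L P hPm.isPrime hpP hram
      (fun I J hI hJ h h' => (hu I hI h).symm.trans (hu J hJ h'))
  obtain ⟨σ, hσ⟩ := aux_frob_s12 p L P hPm.isPrime hpP
  rw [hKdeg] at h1
  rw [hkdeg] at h2
  exact aux_faithful K L hLclosure ℓ q hℓ hq hqℓ hKdeg σ (h1.trans hσ) (h2.trans hσ)
end
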